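/- arXiv:1506.05347 — 2 statements merged into one kernel-verified Lean document; each statement's English description precedes it below -/
import Mathlib

section
/- Let s ∈ ℤ^ℕ and let m ∈ ℤ^ℕ be not eventually periodic (there exist no p ≥ 1 and N ≥ 0 with m_{j+p} = m_j for all j ≥ N). Then the set of addresses r ∈ ℤ^ℕ whose itinerary with respect to s is defined and equals m has at most two elements. -/
open Set Filter Topology

/-- The space of external addresses: integer sequences `s₀ s₁ s₂ …`. -/
abbrev Addr : Type := ℕ → ℤ

/-- The one-sided shift on external addresses. -/
def shift (s : Addr) : Addr := fun n => s (n + 1)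

/-- Strict lexicographic order on external addresses. -/
def lexLt (a b : Addr) : Prop := ∃ n : ℕ, (∀ m : ℕ, m < n → a m = b m) ∧ a n < b n

/-- Prepend an integer entry to an address: `m·s = m s₀ s₁ s₂ …`. -/
def consAddr (m : ℤ) (s : Addr) : Addr := fun n => match n with
  | 0 => m
  | Nat.succ k => s k

/-- The itinerary of `r` with respect to `s` is defined and equals `m`:
`m_j·s < σʲ(r) < (m_j + 1)·s` in lexicographic order for all `j ≥ 0`. -/
def HasItinerary (s r m : Addr) : Prop :=
  ∀ j : ℕ, lexLt (consAddr (m j) s) (shift^[j] r) ∧ lexLt (shift^[j] r) (consAddr (m j + 1) s)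

/-- `a` and `b` first differ at position `n`, where `a` has the smaller entry. -/
def DiffersAt (n : ℕ) (a b : Addr) : Prop := (∀ i < n, a i = b i) ∧ a n < b n

theorem shift_iterate_apply (k : ℕ) (r : Addr) (j : ℕ) : (shift^[k] r) j = r (j + k) := by
  induction k generalizing j r with
  | zero => rfl
  | succ k ih =>
    rw [Function.iterate_succ_apply, ih]
    simp only [shift]
    congr 1

theorem lexLt_iff_toLex {a b : Addr} : lexLt a b ↔ toLex a < toLex b := Iff.rfl

theorem lexLt_trans {a b c : Addr} (hab : lexLt a b) (hbc : lexLt b c) : lexLt a c :=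
  lt_trans (lexLt_iff_toLex.1 hab) (lexLt_iff_toLex.1 hbc)

theorem lexLt_asymm {a b : Addr} (hab : lexLt a b) : ¬ lexLt b a :=
  lt_asymm (lexLt_iff_toLex.1 hab)

theorem lexLt_iff_head {a b : Addr} :
    lexLt a b ↔ a 0 < b 0 ∨ a 0 = b 0 ∧ lexLt (shift a) (shift b) := by
  constructor
  · rintro ⟨n, h, hn⟩
    cases n with
    | zero => exact Or.inl hn
    | succ n => exact Or.inr ⟨h 0 (by omega), n, fun i hi => h (i + 1) (by omega), hn⟩
  · rintro (h | ⟨h0, n, h, hn⟩)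
    · exact ⟨0, fun i hi => absurd hi (by omega), h⟩
    · refine ⟨n + 1, fun i hi => ?_, hn⟩
      cases i with
      | zero => exact h0
      | succ i => exact h i (by omega)

theorem consAddr_lexLt {k : ℤ} {s r : Addr} :
    lexLt (consAddr k s) r ↔ k < r 0 ∨ k = r 0 ∧ lexLt s (shift r) :=
  lexLt_iff_head

theorem lexLt_consAddr {k : ℤ} {s r : Addr} :
    lexLt r (consAddr k s) ↔ r 0 < k ∨ r 0 = k ∧ lexLt (shift r) s :=
  lexLt_iff_head

theorem HasItinerary.shift_iterate {s r m : Addr} (h : HasItinerary s r m) (k : ℕ) :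
    HasItinerary s (shift^[k] r) (shift^[k] m) := by
  intro j
  have := h (j + k)
  rwa [shift_iterate_apply, ← Function.iterate_add_apply]

theorem HasItinerary.head {s r m : Addr} (h : HasItinerary s r m) :
    (r 0 = m 0 ∧ lexLt s (shift r)) ∨ (r 0 = m 0 + 1 ∧ lexLt (shift r) s) := by
  have h0 := h 0
  rw [consAddr_lexLt, lexLt_consAddr] at h0
  simp only [Function.iterate_zero, id_eq] at h0
  obtain ⟨h1 | h1, h2 | h2⟩ := h0
  · omega
  · exact Or.inr h2
  · exact Or.inl ⟨h1.1.symm, h1.2⟩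
  · omega

theorem HasItinerary.entry {s r m : Addr} (h : HasItinerary s r m) (j : ℕ) :
    (r j = m j ∧ lexLt s (shift^[j + 1] r)) ∨ (r j = m j + 1 ∧ lexLt (shift^[j + 1] r) s) := by
  have := (h.shift_iterate j).head
  simpa only [shift_iterate_apply, zero_add, ← Function.iterate_succ_apply' shift] using this

/-- Four addresses are in cyclic order. -/
def CyclicOrder (a b c d : Addr) : Prop :=
  (lexLt a b ∧ lexLt b c ∧ lexLt c d) ∨ (lexLt b c ∧ lexLt c d ∧ lexLt d a) ∨
    (lexLt c d ∧ lexLt d a ∧ lexLt a b) ∨ (lexLt d a ∧ lexLt a b ∧ lexLt b c)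

theorem CyclicOrder.rotate {a b c d : Addr} (h : CyclicOrder a b c d) : CyclicOrder b c d a := by
  unfold CyclicOrder at *
  tauto

theorem shift_lexLt_cases {s x y m n : Addr} (hx : HasItinerary s x m) (hy : HasItinerary s y n)
    (hmn : m 0 = n 0) (h : lexLt x y) :
    (lexLt (shift x) s ∧ lexLt (shift y) s ∧ lexLt (shift x) (shift y)) ∨
      (lexLt s (shift x) ∧ lexLt s (shift y) ∧ lexLt (shift x) (shift y)) ∨
        (lexLt s (shift x) ∧ lexLt (shift y) s) := by
  rw [lexLt_iff_head] at h
  rcases hx.head with ⟨hx0, hx⟩ | ⟨hx0, hx⟩ <;> rcases hy.head with ⟨hy0, hy⟩ | ⟨hy0, hy⟩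
  · exact Or.inr (Or.inl ⟨hx, hy, (h.resolve_left (by omega)).2⟩)
  · exact Or.inr (Or.inr ⟨hx, hy⟩)
  · omega
  · exact Or.inl ⟨hx, hy, (h.resolve_left (by omega)).2⟩

theorem cyclicOrder_shift_of_lexLt {s a b c d m n : Addr}
    (ha : HasItinerary s a m) (hb : HasItinerary s b n)
    (hc : HasItinerary s c m) (hd : HasItinerary s d n) (hmn : m 0 = n 0)
    (hab : lexLt a b) (hbc : lexLt b c) (hcd : lexLt c d) :
    CyclicOrder (shift a) (shift b) (shift c) (shift d) := by
  have h1 := shift_lexLt_cases ha hb hmn hab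
  have h2 := shift_lexLt_cases hb hc hmn.symm hbc
  have h3 := shift_lexLt_cases hc hd hmn hcd
  unfold CyclicOrder
  grind [lexLt_trans, lexLt_asymm]

theorem head_eq_of_between {s a b c m n : Addr}
    (ha : HasItinerary s a m) (hb : HasItinerary s b n) (hc : HasItinerary s c m)
    (hab : lexLt a b) (hbc : lexLt b c) : m 0 = n 0 := by
  have ha' := (ha 0).1
  have hb' := hb 0
  have hc' := (hc 0).2
  simp only [Function.iterate_zero, id_eq] at ha' hb' hc'
  have h1 : lexLt (consAddr (m 0) s) (consAddr (n 0 + 1) s) := by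
    simp only [lexLt_iff_toLex] at *
    order
  have h2 : lexLt (consAddr (n 0) s) (consAddr (m 0 + 1) s) := by
    simp only [lexLt_iff_toLex] at *
    order
  have irrefl : ¬ lexLt s s := lt_irrefl (toLex s)
  rw [consAddr_lexLt] at h1 h2
  have h1' : m 0 < n 0 + 1 := h1.resolve_right fun h => irrefl h.2
  have h2' : n 0 < m 0 + 1 := h2.resolve_right fun h => irrefl h.2
  omega

theorem CyclicOrder.shift {s a b c d m n : Addr} (h : CyclicOrder a b c d)
    (ha : HasItinerary s a m) (hb : HasItinerary s b n)
    (hc : HasItinerary s c m) (hd : HasItinerary s d n) :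
    m 0 = n 0 ∧ CyclicOrder (shift a) (shift b) (shift c) (shift d) := by
  rcases h with ⟨h1, h2, h3⟩ | ⟨h1, h2, h3⟩ | ⟨h1, h2, h3⟩ | ⟨h1, h2, h3⟩
  · have e := head_eq_of_between ha hb hc h1 h2
    exact ⟨e, cyclicOrder_shift_of_lexLt ha hb hc hd e h1 h2 h3⟩
  · have e := head_eq_of_between hb hc hd h1 h2
    exact ⟨e.symm, (cyclicOrder_shift_of_lexLt hb hc hd ha e h1 h2 h3).rotate.rotate.rotate⟩
  · have e := head_eq_of_between hc hd ha h1 h2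
    exact ⟨e, (cyclicOrder_shift_of_lexLt hc hd ha hb e h1 h2 h3).rotate.rotate⟩
  · have e := head_eq_of_between hd ha hb h1 h2
    exact ⟨e.symm, (cyclicOrder_shift_of_lexLt hd ha hb hc e h1 h2 h3).rotate⟩

/-- Pairs of addresses that cross each other have the same itinerary. -/
theorem itinerary_eq_of_crossing {s a b c d m n : Addr}
    (ha : HasItinerary s a m) (hb : HasItinerary s b n)
    (hc : HasItinerary s c m) (hd : HasItinerary s d n)
    (hab : lexLt a b) (hbc : lexLt b c) (hcd : lexLt c d) : m = n := by
  have key : ∀ k, CyclicOrder (shift^[k] a) (shift^[k] b) (shift^[k] c) (shift^[k] d) := by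
    intro k
    induction k with
    | zero => exact Or.inl ⟨hab, hbc, hcd⟩
    | succ k ih =>
      simp only [Function.iterate_succ_apply']
      exact (ih.shift (ha.shift_iterate k) (hb.shift_iterate k) (hc.shift_iterate k)
        (hd.shift_iterate k)).2
  funext k
  have := ((key k).shift (ha.shift_iterate k) (hb.shift_iterate k) (hc.shift_iterate k)
    (hd.shift_iterate k)).1
  simpa only [shift_iterate_apply, zero_add] using this

theorem HasItinerary.unique {s a m n : Addr} (hm : HasItinerary s a m)
    (hn : HasItinerary s a n) : m = n := by
  have irrefl : ¬ lexLt s s := lt_irrefl (toLex s)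
  funext j
  have h1 := hm j
  have h2 := hn j
  have h3 : lexLt (consAddr (m j) s) (consAddr (n j + 1) s) := lexLt_trans h1.1 h2.2
  have h4 : lexLt (consAddr (n j) s) (consAddr (m j + 1) s) := lexLt_trans h2.1 h1.2
  rw [consAddr_lexLt] at h3 h4
  have h3' : m j < n j + 1 := h3.resolve_right fun h => irrefl h.2
  have h4' : n j < m j + 1 := h4.resolve_right fun h => irrefl h.2
  omega

/-- A triple of addresses with common itinerary `m` such that `s` separates `a` from `b`, and
`c` is not between `a` and `b`. The gap containing `s` has first difference `E`; the other
bounded gap has first difference `F`. -/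
structure SeparatedTriple (s m a b c : Addr) (E F : ℕ) : Prop where
  itin_a : HasItinerary s a m
  itin_b : HasItinerary s b m
  itin_c : HasItinerary s c m
  lt_s : lexLt a s
  s_lt : lexLt s b
  diff_gap : DiffersAt E a b
  diff_side : DiffersAt F c a ∨ DiffersAt F b c

theorem DiffersAt.shift_iterate {n k : ℕ} {a b : Addr} (h : DiffersAt (n + k) a b) :
    DiffersAt n (shift^[k] a) (shift^[k] b) := by
  refine ⟨fun i hi => ?_, ?_⟩
  · simpa only [shift_iterate_apply] using h.1 (i + k) (by omega)
  · simpa only [shift_iterate_apply] using h.2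

theorem exists_separatedTriple {s m x y z : Addr} (hx : HasItinerary s x m)
    (hy : HasItinerary s y m) (hz : HasItinerary s z m) {p q : ℕ}
    (hp : DiffersAt p x y) (hq : DiffersAt q y z) :
    ∃ t a b c E F, 0 < t ∧ SeparatedTriple s (shift^[t] m) a b c E F ∧
      (F + 1 + p = q ∨ F + 1 + q = p) := by
  rcases lt_trichotomy p q with h | h | h
  · obtain ⟨F, rfl⟩ : ∃ F, q = F + (p + 1) := ⟨q - (p + 1), by omega⟩
    have e1 := hp.2
    have e2 := hq.1 p h
    have hx' := hx.entry p
    have hy' := hy.entry p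
    have hz' := hz.entry p
    have hxs : lexLt s (shift^[p + 1] x) := by
      rcases hx' with h | h
      · exact h.2
      · omega
    have hzs : lexLt (shift^[p + 1] z) s := by
      rcases hz' with h | h
      · omega
      · exact h.2
    obtain ⟨E, hE⟩ : lexLt (shift^[p + 1] z) (shift^[p + 1] x) := lexLt_trans hzs hxs
    exact ⟨p + 1, _, _, _, E, F, by omega, ⟨hz.shift_iterate _, hx.shift_iterate _,
      hy.shift_iterate _, hzs, hxs, hE, Or.inl hq.shift_iterate⟩, by omega⟩
  · subst h
    have e1 := hp.2
    have e2 := hq.2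
    have hx' := hx.entry p
    have hz' := hz.entry p
    omega
  · obtain ⟨F, rfl⟩ : ∃ F, p = F + (q + 1) := ⟨p - (q + 1), by omega⟩
    have e1 := hq.2
    have e2 := hp.1 q h
    have hx' := hx.entry q
    have hy' := hy.entry q
    have hz' := hz.entry q
    have hxs : lexLt s (shift^[q + 1] x) := by
      rcases hx' with h | h
      · exact h.2
      · omega
    have hzs : lexLt (shift^[q + 1] z) s := by
      rcases hz' with h | h
      · omega
      · exact h.2
    obtain ⟨E, hE⟩ : lexLt (shift^[q + 1] z) (shift^[q + 1] x) := lexLt_trans hzs hxs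
    exact ⟨q + 1, _, _, _, E, F, by omega, ⟨hz.shift_iterate _, hx.shift_iterate _,
      hy.shift_iterate _, hzs, hxs, hE, Or.inr hp.shift_iterate⟩, by omega⟩

theorem SeparatedTriple.exists_next {s m a b c : Addr} {E F : ℕ}
    (h : SeparatedTriple s m a b c E F) :
    ∃ t a' b' c' E' F', 0 < t ∧ SeparatedTriple s (shift^[t] m) a' b' c' E' F' ∧
      (F' + 1 + E = F ∨ F' + 1 + F = E) := by
  rcases h.diff_side with h' | h'
  · obtain ⟨t, a', b', c', E', F', h1, h2, h3⟩ :=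
      exists_separatedTriple h.itin_c h.itin_a h.itin_b h' h.diff_gap
    exact ⟨t, a', b', c', E', F', h1, h2, h3.symm⟩
  · exact exists_separatedTriple h.itin_a h.itin_b h.itin_c h.diff_gap h'

theorem DiffersAt.le_of_le_of_le {a b x y : Addr} {E n : ℕ} (h : DiffersAt E a b)
    (hax : toLex a ≤ toLex x) (hyb : toLex y ≤ toLex b) (hn : DiffersAt n x y) : E ≤ n := by
  by_contra! hlt
  have agree : ∀ i ≤ n, x i = a i ∧ y i = a i := by
    intro i
    induction i using Nat.strong_induction_on with
    | _ i ih =>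
      intro hi
      have hab := h.1 i (by omega)
      have hxa : a i ≤ x i := by
        by_contra! hc
        exact absurd (show toLex x < toLex a from
          ⟨i, fun j hj => (ih j hj (by omega)).1, hc⟩) (not_lt.2 hax)
      have hyb' : y i ≤ b i := by
        by_contra! hc
        exact absurd (show toLex b < toLex y from
          ⟨i, fun j hj => (h.1 j (by omega)).symm.trans (ih j hj (by omega)).2.symm, hc⟩)
          (not_lt.2 hyb)
      have hxy' : x i ≤ y i := by
        rcases hi.eq_or_lt with rfl | hi
        · exact hn.2.le
        · exact (hn.1 i hi).le
      omega
  have h1 := agree n le_rfl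
  have h2 := hn.2
  omega

theorem SeparatedTriple.nested {s m n a b c a' b' c' : Addr} {E F E' F' : ℕ}
    (h : SeparatedTriple s m a b c E F) (h' : SeparatedTriple s n a' b' c' E' F') (hmn : m ≠ n)
    (haa : lexLt a a') : E ≤ E' ∧ E ≤ F' := by
  have hs := h.lt_s
  have hs' := h'.lt_s
  have ht := h.s_lt
  have ht' := h'.s_lt
  have ne : ∀ {u v}, HasItinerary s u m → HasItinerary s v n → toLex u ≠ toLex v := by
    intro u v hu hv huv
    obtain rfl : u = v := huv
    exact hmn (hu.unique hv)
  have hbb : lexLt b' b := by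
    rcases lt_or_gt_of_ne (ne h.itin_b h'.itin_b) with hb | hb
    · exact absurd (itinerary_eq_of_crossing h.itin_a h'.itin_a h.itin_b h'.itin_b haa
        (lexLt_trans hs' ht) hb) hmn
    · exact hb
  refine ⟨h.diff_gap.le_of_le_of_le (le_of_lt haa) (le_of_lt hbb) h'.diff_gap, ?_⟩
  rcases h'.diff_side with hc | hc
  · have hac : lexLt a c' := by
      rcases lt_or_gt_of_ne (ne h.itin_a h'.itin_c) with hl | hl
      · exact hl
      · exact absurd (itinerary_eq_of_crossing h'.itin_c h.itin_a h'.itin_a h.itin_b hl haa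
          (lexLt_trans hs' ht)).symm hmn
    exact h.diff_gap.le_of_le_of_le (le_of_lt hac) (le_of_lt (lexLt_trans hs' ht)) hc
  · have hcb : lexLt c' b := by
      rcases lt_or_gt_of_ne (ne h.itin_b h'.itin_c) with hl | hl
      · exact absurd (itinerary_eq_of_crossing h.itin_a h'.itin_b h.itin_b h'.itin_c
          (lexLt_trans hs ht') hbb hl) hmn
      · exact hl
    exact h.diff_gap.le_of_le_of_le (le_of_lt (lexLt_trans hs ht')) (le_of_lt hcb) hc

theorem SeparatedTriple.nested_or_nested {s m n a b c a' b' c' : Addr} {E F E' F' : ℕ}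
    (h : SeparatedTriple s m a b c E F) (h' : SeparatedTriple s n a' b' c' E' F') (hmn : m ≠ n) :
    (E ≤ E' ∧ E ≤ F') ∨ (E' ≤ E ∧ E' ≤ F) := by
  rcases lt_trichotomy (toLex a) (toLex a') with haa | haa | haa
  · exact Or.inl (h.nested h' hmn haa)
  · obtain rfl : a = a' := haa
    exact absurd (h.itin_a.unique h'.itin_a) hmn
  · exact Or.inr (h'.nested h hmn.symm haa)

/-- No pair of sequences of gap lengths is compatible with both the recursion for consecutive
separated triples and the pairwise nesting of separated triples. -/
theorem false_of_gap_sequences {E F : ℕ → ℕ}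
    (hstep : ∀ n, F (n + 1) + 1 + E n = F n ∨ F (n + 1) + 1 + F n = E n)
    (hnest : ∀ n k, n < k → (E n ≤ E k ∧ E n ≤ F k) ∨ (E k ≤ E n ∧ E k ≤ F n)) : False := by
  have record : ∀ n, (∀ k < n, E k < E n) → n ≤ F 0 := by
    intro n hn
    have hF : ∀ k < n, E k ≤ F n := fun k hk => by
      have := hn k hk
      have := hnest k n hk
      omega
    have : ∀ i ≤ n, F n + i ≤ F (n - i) := by
      intro i
      induction i with
      | zero => simp
      | succ i ih =>
        intro hi
        have h1 := ih (by omega)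
        have h2 := hstep (n - (i + 1))
        rw [show n - (i + 1) + 1 = n - i by omega] at h2
        have h3 := hF (n - (i + 1)) (by omega)
        omega
    have := this n le_rfl
    simp only [Nat.sub_self] at this
    omega
  have bdd : ∃ B, ∀ n, E n ≤ B := by
    classical
    by_contra! hB
    have hex := hB ((Finset.range (F 0 + 1)).sup E)
    have hle : ∀ k ≤ F 0, E k ≤ (Finset.range (F 0 + 1)).sup E := fun k hk =>
      Finset.le_sup (Finset.mem_range.2 (by omega))
    have h1 := Nat.find_spec hex
    have h2 := record (Nat.find hex) fun k hk => by
      have := Nat.find_min hex hk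
      omega
    have := hle _ h2
    omega
  obtain ⟨B, hB⟩ := bdd
  have fin : {n | F n < E n}.Finite := by
    refine Set.Finite.of_injOn (f := E) (t := Set.Iic B) (fun n _ => hB n) ?_ (Set.finite_Iic B)
    intro n hn k hk hnk
    simp only [Set.mem_ofPred_eq] at hn hk
    rcases lt_trichotomy n k with h | h | h
    · have := hnest n k h
      omega
    · exact h
    · have := hnest k n h
      omega
  obtain ⟨N, hN⟩ := fin.bddAbove
  have hdec : ∀ i, F (N + 1 + i) + i ≤ F (N + 1) := by
    intro i
    induction i with
    | zero => simp
    | succ i ih =>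
      have h1 := hstep (N + 1 + i)
      have h2 : ¬ F (N + 1 + i) < E (N + 1 + i) := fun h => by
        have : N + 1 + i ≤ N := hN h
        omega
      rw [show N + 1 + (i + 1) = N + 1 + i + 1 by omega]
      omega
  have := hdec (F (N + 1) + 1)
  omega

theorem not_lexLt_triple {s m : Addr}
    (hm : ¬ ∃ p : ℕ, 1 ≤ p ∧ ∃ N : ℕ, ∀ j : ℕ, N ≤ j → m (j + p) = m j)
    {x y z : Addr} (hx : HasItinerary s x m) (hy : HasItinerary s y m)
    (hz : HasItinerary s z m) (hxy : lexLt x y) (hyz : lexLt y z) : False := by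
  have hne : ∀ {t u : ℕ}, t < u → shift^[t] m ≠ shift^[u] m := by
    intro t u htu h
    refine hm ⟨u - t, by omega, t, fun j hj => ?_⟩
    have := congrFun h (j - t)
    rw [shift_iterate_apply, shift_iterate_apply] at this
    rw [show j + (u - t) = j - t + u by omega, ← this]
    congr 1
    omega
  obtain ⟨p, hp⟩ := hxy
  obtain ⟨q, hq⟩ := hyz
  obtain ⟨t₀, a₀, b₀, c₀, E₀, F₀, -, h₀, -⟩ := exists_separatedTriple hx hy hz hp hq
  let State := {w : ℕ × ℕ × ℕ // ∃ a b c, SeparatedTriple s (shift^[w.1] m) a b c w.2.1 w.2.2}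
  have next : ∀ w : State, ∃ w' : State, w.1.1 < w'.1.1 ∧
      (w'.1.2.2 + 1 + w.1.2.1 = w.1.2.2 ∨ w'.1.2.2 + 1 + w.1.2.2 = w.1.2.1) := by
    rintro ⟨⟨t, E, F⟩, a, b, c, h⟩
    obtain ⟨u, a', b', c', E', F', hu, h', hEF⟩ := h.exists_next
    rw [← Function.iterate_add_apply] at h'
    exact ⟨⟨(u + t, E', F'), a', b', c', h'⟩, by simpa using hu, hEF⟩
  choose f hf hf' using next
  let w : ℕ → State := fun n => f^[n] ⟨(t₀, E₀, F₀), a₀, b₀, c₀, h₀⟩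
  have hw : ∀ n, w (n + 1) = f (w n) := fun n => Function.iterate_succ_apply' f n _
  have mono : StrictMono fun n => (w n).1.1 := strictMono_nat_of_lt_succ fun n => by
    rw [hw]
    exact hf _
  refine false_of_gap_sequences (E := fun n => (w n).1.2.1) (F := fun n => (w n).1.2.2)
    (fun n => ?_) fun n k hnk => ?_
  · simp only [hw]
    exact hf' _
  · obtain ⟨a, b, c, h⟩ := (w n).2
    obtain ⟨a', b', c', h'⟩ := (w k).2
    exact h.nested_or_nested h' (hne (mono hnk))

/-- **At most two addresses share a non-eventually-periodic itinerary.** If `m` is not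
eventually periodic, then at most two addresses have itinerary (with respect to `s`)
defined and equal to `m`. -/
theorem at_most_two_addresses_share_aperiodic_itinerary (s m : Addr)
    (hm : ¬ ∃ p : ℕ, 1 ≤ p ∧ ∃ N : ℕ, ∀ j : ℕ, N ≤ j → m (j + p) = m j) :
    ∀ r1 r2 r3 : Addr, HasItinerary s r1 m → HasItinerary s r2 m → HasItinerary s r3 m →
      r1 = r2 ∨ r1 = r3 ∨ r2 = r3 := by
  intro r1 r2 r3 h1 h2 h3
  by_contra! hne
  obtain ⟨h12, h13, h23⟩ := hne
  have total : ∀ {u v : Addr}, u ≠ v → lexLt u v ∨ lexLt v u := fun {u v} h =>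
    lt_or_gt_of_ne (a := toLex u) (b := toLex v) h
  rcases total h12 with l12 | l12 <;> rcases total h13 with l13 | l13 <;>
    rcases total h23 with l23 | l23
  · exact not_lexLt_triple hm h1 h2 h3 l12 l23
  · exact not_lexLt_triple hm h1 h3 h2 l13 l23
  · exact not_lexLt_triple hm h1 h2 h3 l12 l23
  · exact not_lexLt_triple hm h3 h1 h2 l13 l12
  · exact not_lexLt_triple hm h2 h1 h3 l12 l13
  · exact not_lexLt_triple hm h2 h1 h3 l12 l13
  · exact not_lexLt_triple hm h2 h3 h1 l23 l13
  · exact not_lexLt_triple hm h3 h2 h1 l23 l12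
end

section
/- Let Q ≥ 0, let J_{≥Q}(𝓕) = {x ∈ J(𝓕) : T(𝓕ʲ(x)) ≥ Q for all j ≥ 0}, and let Ẽ_{≥Q}(𝓕) = Ẽ(𝓕) ∩ J_{≥Q}(𝓕). Then: (a) if s⁰ ∈ ℤ^ℕ is exponentially bounded and (t_{s⁰}, s⁰) ∈ J_{≥Q}(𝓕), then X_{s⁰}(𝓕) ⊆ J_{≥Q}(𝓕), where X_{s⁰}(𝓕) = {x ∈ J(𝓕) : |s_n(x)| ≥ |s⁰_n| for all n ≥ 0}; and (b) ∞ is an explosion point for Ẽ_{≥Q}(𝓕) ∪ {∞}: the set Ẽ_{≥Q}(𝓕) ∪ {∞} is connected in the one-point compactification of ℝ × ℤ^ℕ and Ẽ_{≥Q}(𝓕) is totally separated. -/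
open Set Filter Topology OnePoint

noncomputable section

/-- The model map `𝓕(t, s) = (F(t) − 2π|s₁|, σ(s))`, where `F(t) = eᵗ − 1`. -/
def Fmodel : ℝ × Addr → ℝ × Addr :=
  fun x => (Real.exp x.1 - 1 - 2 * Real.pi * |(x.2 1 : ℝ)|, shift x.2)

/-- The model Julia set `J(𝓕)`: points whose forward orbit stays in `[0,∞) × ℤ^ℕ`. -/
def JF : Set (ℝ × Addr) := {x | ∀ n : ℕ, 0 ≤ (Fmodel^[n] x).1}

/-- The model escaping set `I(𝓕)`. -/
def IF : Set (ℝ × Addr) :=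
  {x | x ∈ JF ∧ Tendsto (fun n => (Fmodel^[n] x).1) atTop atTop}

/-- An address `s` is exponentially bounded if `(t, s) ∈ J(𝓕)` for some `t`. -/
def ExpBounded (s : Addr) : Prop := ∃ t : ℝ, (t, s) ∈ JF

/-- The minimal potential `t_s = min {t ≥ 0 : (t, s) ∈ J(𝓕)}` of an address `s`. -/
def tmin (s : Addr) : ℝ := sInf {t | (t, s) ∈ JF}

/-- An exponentially bounded address `s` is fast if the endpoint `(t_s, s)` escapes. -/
def Fast (s : Addr) : Prop := ExpBounded s ∧ (tmin s, s) ∈ IF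

/-- The set `Ẽ(𝓕)` of escaping endpoints of the model: the points `(t_s, s)` for fast `s`. -/
def escEndF : Set (ℝ × Addr) := {x | ∃ s : Addr, Fast s ∧ x = (tmin s, s)}

/-- The inverse `F⁻¹(t) = log(1 + t)` of `F(t) = eᵗ − 1`. -/
def Finv (t : ℝ) : ℝ := Real.log (1 + t)

/-- The set `J_{≥Q}(𝓕)` of points whose orbit stays at potential at least `Q`. -/
def JQ (Q : ℝ) : Set (ℝ × Addr) := {x | x ∈ JF ∧ ∀ j : ℕ, Q ≤ (Fmodel^[j] x).1}

/-- The sub-fan `X_{s⁰}(𝓕) = {x ∈ J(𝓕) : |s_n(x)| ≥ |s⁰_n| for all n ≥ 0}`. -/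
def Xsub (s0 : Addr) : Set (ℝ × Addr) := {x | x ∈ JF ∧ ∀ n : ℕ, |s0 n| ≤ |x.2 n|}

@[simp] theorem Fmodel_iterate_snd (n : ℕ) (x : ℝ × Addr) (k : ℕ) :
    (Fmodel^[n] x).2 k = x.2 (k + n) := by
  induction n generalizing k with
  | zero => rfl
  | succ n ih =>
    rw [Function.iterate_succ_apply']
    change (Fmodel^[n] x).2 (k + 1) = _
    rw [ih, add_right_comm, add_assoc]

theorem Fmodel_iterate_succ_fst (n : ℕ) (x : ℝ × Addr) :
    (Fmodel^[n + 1] x).1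
      = Real.exp (Fmodel^[n] x).1 - 1 - 2 * Real.pi * |(x.2 (n + 1) : ℝ)| := by
  rw [Function.iterate_succ_apply']
  change Real.exp (Fmodel^[n] x).1 - 1 - 2 * Real.pi * |((Fmodel^[n] x).2 1 : ℝ)| = _
  rw [Fmodel_iterate_snd, add_comm 1 n]

/-- The address `u` dominates `s` if `|sₙ| ≤ |uₙ|` for all `n`. -/
def Dominates (u s : Addr) : Prop := ∀ n, |s n| ≤ |u n|

theorem Dominates.refl (s : Addr) : Dominates s s := fun _ => le_rfl

theorem Dominates.trans {r s u : Addr} (h : Dominates u s) (h' : Dominates s r) :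
    Dominates u r := fun n => (h' n).trans (h n)

theorem Dominates.shift {s u : Addr} (h : Dominates u s) : Dominates (shift u) (shift s) :=
  fun n => h (n + 1)

theorem Fmodel_iterate_fst_mono {x y : ℝ × Addr} (ht : x.1 ≤ y.1)
    (hs : ∀ n, |y.2 (n + 1)| ≤ |x.2 (n + 1)|) (n : ℕ) :
    (Fmodel^[n] x).1 ≤ (Fmodel^[n] y).1 := by
  induction n with
  | zero => exact ht
  | succ n ih =>
    rw [Fmodel_iterate_succ_fst, Fmodel_iterate_succ_fst]
    have h : |(y.2 (n + 1) : ℝ)| ≤ |(x.2 (n + 1) : ℝ)| := by exact_mod_cast hs n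
    gcongr

theorem JF_mono {x y : ℝ × Addr} (hx : x ∈ JF) (ht : x.1 ≤ y.1)
    (hs : ∀ n, |y.2 (n + 1)| ≤ |x.2 (n + 1)|) : y ∈ JF :=
  fun n => (hx n).trans (Fmodel_iterate_fst_mono ht hs n)

theorem Fmodel_iterate_mem_JF {x : ℝ × Addr} (hx : x ∈ JF) (n : ℕ) : Fmodel^[n] x ∈ JF :=
  fun m => by rw [← Function.iterate_add_apply]; exact hx _

theorem continuous_Fmodel : Continuous Fmodel := by
  unfold Fmodel shift
  have h : Continuous fun x : ℝ × Addr => ((x.2 1 : ℤ) : ℝ) :=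
    continuous_of_discreteTopology.comp ((continuous_apply 1).comp continuous_snd)
  refine Continuous.prodMk (by fun_prop) ?_
  exact continuous_pi fun n => (continuous_apply (n + 1)).comp continuous_snd

theorem isClosed_JF : IsClosed JF := by
  have h : JF = ⋂ n : ℕ, {x | 0 ≤ (Fmodel^[n] x).1} := by ext; simp [JF]
  rw [h]
  exact isClosed_iInter fun n =>
    isClosed_le continuous_const (continuous_fst.comp (continuous_Fmodel.iterate n))

theorem tmin_le {t : ℝ} {s : Addr} (h : (t, s) ∈ JF) : tmin s ≤ t :=
  csInf_le ⟨0, fun _ hu => hu 0⟩ h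

theorem ExpBounded.tmin_mem {s : Addr} (h : ExpBounded s) : (tmin s, s) ∈ JF :=
  (isClosed_JF.preimage (by fun_prop : Continuous fun t : ℝ => (t, s))).csInf_mem h
    ⟨0, fun _ hu => hu 0⟩

theorem tmin_le_tmin {s u : Addr} (hu : ExpBounded u) (h : Dominates u s) : tmin s ≤ tmin u :=
  tmin_le (JF_mono hu.tmin_mem le_rfl fun n => h (n + 1))

theorem ExpBounded.shift {s : Addr} (h : ExpBounded s) : ExpBounded (shift s) :=
  ⟨_, Fmodel_iterate_mem_JF h.tmin_mem 1⟩

theorem Fmodel_tmin {s : Addr} (h : ExpBounded s) :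
    Fmodel (tmin s, s) = (tmin (shift s), shift s) := by
  refine Prod.ext (le_antisymm ?_ (tmin_le (Fmodel_iterate_mem_JF h.tmin_mem 1))) rfl
  have h0 : 0 ≤ tmin (shift s) := h.shift.tmin_mem 0
  set c := tmin (shift s) + 2 * Real.pi * |(s 1 : ℝ)| with hc
  have hc0 : 0 ≤ c := by positivity
  have hF : Fmodel (Finv c, s) = (tmin (shift s), shift s) := by
    simp only [Fmodel, Finv, Real.exp_log (by positivity : 0 < 1 + c)]
    refine Prod.ext ?_ rfl
    simp only [hc]
    ring
  have hmem : (Finv c, s) ∈ JF := by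
    rintro (_ | n)
    · exact Real.log_nonneg (by linarith)
    · rw [Function.iterate_succ_apply, hF]
      exact h.shift.tmin_mem n
  rw [← congrArg Prod.fst hF]
  exact Fmodel_iterate_fst_mono (x := (tmin s, s)) (y := (Finv c, s))
    (tmin_le hmem) (fun _ => le_rfl) 1

/-- The orbit of an endpoint lies below the orbit of every point with a dominating address. -/
theorem Fmodel_iterate_tmin_le {s : Addr} {x : ℝ × Addr} (hs : ExpBounded s) (hx : x ∈ JF)
    (h : Dominates x.2 s) (n : ℕ) : (Fmodel^[n] (tmin s, s)).1 ≤ (Fmodel^[n] x).1 := by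
  induction n generalizing s x with
  | zero => exact tmin_le (JF_mono hx le_rfl fun n => h (n + 1))
  | succ n ih =>
    rw [Function.iterate_succ_apply, Function.iterate_succ_apply, Fmodel_tmin hs]
    exact ih hs.shift (Fmodel_iterate_mem_JF hx 1) h.shift

theorem mem_JQ_of_dominates {Q : ℝ} {s : Addr} {x : ℝ × Addr} (hs : ExpBounded s)
    (hQ : (tmin s, s) ∈ JQ Q) (hx : x ∈ JF) (h : Dominates x.2 s) : x ∈ JQ Q :=
  ⟨hx, fun n => (hQ.2 n).trans (Fmodel_iterate_tmin_le hs hx h n)⟩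

theorem Fast.of_dominates {s u : Addr} (hs : Fast s) (hu : ExpBounded u) (h : Dominates u s) :
    Fast u :=
  ⟨hu, hu.tmin_mem,
    tendsto_atTop_mono (Fmodel_iterate_tmin_le hs.1 hu.tmin_mem h) hs.2.2⟩

theorem mem_escEndF_iff {s : Addr} : (tmin s, s) ∈ escEndF ↔ Fast s := by
  constructor
  · rintro ⟨u, hu, h⟩
    obtain rfl : s = u := congrArg Prod.snd h
    exact hu
  · exact fun h => ⟨s, h, rfl⟩

/-- The model map separates two points with the same address at a definite rate. -/
theorem le_Fmodel_iterate_sub {a b : ℝ} {s : Addr} (ha : (a, s) ∈ JF) (hab : a ≤ b) (n : ℕ) :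
    (b - a) + n * ((b - a) ^ 2 / 2) ≤ (Fmodel^[n] (b, s)).1 - (Fmodel^[n] (a, s)).1 := by
  induction n with
  | zero => simp
  | succ n ih =>
    rw [Fmodel_iterate_succ_fst, Fmodel_iterate_succ_fst]
    have hA := ha n
    set A := (Fmodel^[n] (a, s)).1
    set B := (Fmodel^[n] (b, s)).1
    have hd : b - a ≤ B - A := by
      have : 0 ≤ (n : ℝ) * ((b - a) ^ 2 / 2) := by positivity
      linarith
    have h0 : 0 ≤ b - a := sub_nonneg.2 hab
    have hexp := Real.quadratic_le_exp_of_nonneg (h0.trans hd)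
    have hsq : (b - a) ^ 2 ≤ (B - A) ^ 2 := by gcongr
    have hmul : Real.exp B = Real.exp A * Real.exp (B - A) := by
      rw [← Real.exp_add, add_sub_cancel]
    have hA1 : 1 ≤ Real.exp A := Real.one_le_exp hA
    have hB1 : 1 ≤ Real.exp (B - A) := Real.one_le_exp (h0.trans hd)
    push_cast
    nlinarith [mul_nonneg (sub_nonneg.2 hA1) (sub_nonneg.2 hB1)]

/-- Every point of `J(𝓕)` is a limit of endpoints with dominating addresses. -/
theorem exists_dominates_tmin_near {t : ℝ} {s : Addr} (hx : (t, s) ∈ JF) {ε : ℝ} (hε : 0 < ε)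
    (N : ℕ) : ∃ u : Addr, ExpBounded u ∧ Dominates u s ∧ (∀ n < N, u n = s n) ∧
      tmin u ≤ t ∧ t - ε < tmin u := by
  obtain ⟨m, hm⟩ := exists_nat_gt (2 * Real.pi / (ε ^ 2 / 2))
  rw [div_lt_iff₀ (by positivity)] at hm
  set n := m + N + 1 with hn
  set r : Addr := (Fmodel^[n] (t, s)).2 with hr
  have hJ : ((Fmodel^[n] (t, s)).1, r) ∈ JF := Fmodel_iterate_mem_JF hx n
  have hr0 : ExpBounded r := ⟨_, hJ⟩
  set k : ℤ := ⌊((Fmodel^[n] (t, s)).1 - tmin r) / (2 * Real.pi)⌋ with hk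
  have hpi : 0 < 2 * Real.pi := by positivity
  have hk0 : 0 ≤ k := Int.floor_nonneg.2 (div_nonneg (sub_nonneg.2 (tmin_le hJ)) hpi.le)
  have hk1 : k * (2 * Real.pi) ≤ (Fmodel^[n] (t, s)).1 - tmin r :=
    (le_div_iff₀ hpi).1 (Int.floor_le _)
  have hk2 : (Fmodel^[n] (t, s)).1 - tmin r < (k + 1) * (2 * Real.pi) :=
    (div_lt_iff₀ hpi).1 (Int.lt_floor_add_one _)
  set u : Addr := Function.update s n (|s n| + k) with hu
  have hun : |u n| = |s n| + k := by
    rw [hu, Function.update_self, abs_of_nonneg (by positivity)]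
  have hu' : ∀ j, j ≠ n → u j = s j := fun j hj => Function.update_of_ne hj _ _
  have hdom : Dominates u s := fun j => by
    by_cases hj : j = n
    · subst hj; rw [hun]; linarith
    · rw [hu' j hj]
  have hlow : ∀ j < n, (Fmodel^[j] (t, u)).1 = (Fmodel^[j] (t, s)).1 := by
    intro j hj
    induction j with
    | zero => rfl
    | succ j ih =>
      rw [Fmodel_iterate_succ_fst, Fmodel_iterate_succ_fst, ih (by omega)]
      simp only [hu' (j + 1) hj.ne]
  have hTn : (Fmodel^[n] (t, u)).1 = (Fmodel^[n] (t, s)).1 - k * (2 * Real.pi) := by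
    have hun' : |(u n : ℝ)| = |(s n : ℝ)| + k := by exact_mod_cast hun
    rw [hn, Fmodel_iterate_succ_fst, Fmodel_iterate_succ_fst, hlow _ (by omega)]
    simp only [← hn, hun']
    ring
  have htail : ∀ j, (Fmodel^[n] (t, u)).2 (j + 1) = r (j + 1) := fun j => by
    rw [hr, Fmodel_iterate_snd, Fmodel_iterate_snd]
    exact hu' _ (by omega)
  have hmem : (t, u) ∈ JF := by
    intro j
    rcases lt_or_ge j n with hj | hj
    · rw [hlow j hj]; exact hx j
    · obtain ⟨i, rfl⟩ := Nat.exists_eq_add_of_le' hj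
      rw [Function.iterate_add_apply]
      exact JF_mono hr0.tmin_mem (by rw [hTn]; linarith) (fun j => by rw [htail]) i
  have hub : ExpBounded u := ⟨t, hmem⟩
  refine ⟨u, hub, hdom, fun j hj => hu' j (by omega), tmin_le hmem, ?_⟩
  by_contra! hcon
  have hsep := le_Fmodel_iterate_sub hub.tmin_mem (tmin_le hmem) n
  have hge : tmin r ≤ (Fmodel^[n] (tmin u, u)).1 := by
    refine tmin_le (JF_mono (Fmodel_iterate_mem_JF hub.tmin_mem n) le_rfl fun j => ?_)
    change |r (j + 1)| ≤ _
    rw [← htail, Fmodel_iterate_snd, Fmodel_iterate_snd]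
  have hmn : (m : ℝ) ≤ n := by exact_mod_cast (by omega : m ≤ n)
  have hεt : ε ≤ t - tmin u := by linarith
  have hmul : (m : ℝ) * (ε ^ 2 / 2) ≤ n * ((t - tmin u) ^ 2 / 2) := by gcongr
  linarith

theorem tendsto_addr_of_agree {f : ℕ → Addr} {s : Addr} (h : ∀ k, ∀ n < k, f k n = s n) :
    Tendsto f atTop (𝓝 s) :=
  tendsto_pi_nhds.2 fun n =>
    tendsto_const_nhds.congr' <| (eventually_gt_atTop n).mono fun k hk => (h k n hk).symm

/-- A family of endpoints with bounded potentials cannot be both closed under limits along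
dominating addresses and open under small increases to dominating addresses. -/
theorem false_of_bounded_clopen {P : Addr → Prop} {R : ℝ} (hP : ∀ s, P s → ExpBounded s)
    (hR : ∀ s, P s → tmin s ≤ R) {s₀ : Addr} (hs₀ : P s₀)
    (hclosed : ∀ (f : ℕ → Addr) (s : Addr), (∀ k, P (f k)) → ExpBounded s →
      Dominates s (f 0) →
      Tendsto (fun k => (tmin (f k), f k)) atTop (𝓝 (tmin s, s)) → P s)
    (hopen : ∀ s, P s → ∃ V ∈ 𝓝 (tmin s, s), ∀ u, ExpBounded u → Dominates u s →
      (tmin u, u) ∈ V → P u) : False := by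
  have step : ∀ (k : ℕ) (s : Addr), P s → ∃ u, P u ∧ Dominates u s ∧ (∀ n < k, u n = s n) ∧
      ∀ w, P w → Dominates w s → (∀ n < k, w n = s n) → tmin w ≤ tmin u + 1 / (k + 1) := by
    intro k s hs
    set S : Set ℝ := tmin '' {w | P w ∧ Dominates w s ∧ ∀ n < k, w n = s n} with hS
    have hne : S.Nonempty := ⟨_, s, ⟨hs, .refl s, fun _ _ => rfl⟩, rfl⟩
    have hbdd : BddAbove S := ⟨R, by rintro _ ⟨w, hw, rfl⟩; exact hR w hw.1⟩
    have hk : sSup S - 1 / ((k : ℝ) + 1) < sSup S := sub_lt_self _ (by positivity)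
    obtain ⟨_, ⟨u, hu, rfl⟩, hlt⟩ := exists_lt_of_lt_csSup hne hk
    refine ⟨u, hu.1, hu.2.1, hu.2.2, fun w hw hws hwk => ?_⟩
    have : tmin w ≤ sSup S := le_csSup hbdd ⟨w, ⟨hw, hws, hwk⟩, rfl⟩
    linarith
  choose g hgP hgD hgA hgM using step
  let F : ℕ → {s // P s} := fun k =>
    Nat.rec ⟨s₀, hs₀⟩ (fun k s => ⟨g k s.1 s.2, hgP k s.1 s.2⟩) k
  let f : ℕ → Addr := fun k => (F k).1
  have hfP : ∀ k, P (f k) := fun k => (F k).2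
  have hfD : ∀ k, Dominates (f (k + 1)) (f k) := fun k => hgD k _ (hfP k)
  have hfA : ∀ k, ∀ n < k, f (k + 1) n = f k n := fun k => hgA k _ (hfP k)
  have hfM : ∀ k w, P w → Dominates w (f k) → (∀ n < k, w n = f k n) →
      tmin w ≤ tmin (f (k + 1)) + 1 / (k + 1) := fun k => hgM k _ (hfP k)
  have hD : ∀ i j, i ≤ j → Dominates (f j) (f i) := fun i j hij => by
    induction j, hij using Nat.le_induction with
    | base => exact .refl _
    | succ j _ ih => exact (hfD j).trans ih
  have hA : ∀ i j, i ≤ j → ∀ n < i, f j n = f i n := fun i j hij n hn => by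
    induction j, hij using Nat.le_induction with
    | base => rfl
    | succ j hj ih => rw [hfA j n (hn.trans_le hj), ih]
  let s : Addr := fun n => f (n + 1) n
  have hsA : ∀ k, ∀ n < k, f k n = s n := fun k n hn => hA (n + 1) k hn n n.lt_succ_self
  have hsD : ∀ k, Dominates s (f k) := fun k n => by
    rcases le_total (n + 1) k with h | h
    · rw [hsA k n h]
    · exact hD k (n + 1) h n
  have hmono : Monotone fun k => tmin (f k) := fun i j hij =>
    tmin_le_tmin (hP _ (hfP j)) (hD i j hij)
  have hbdd : BddAbove (range fun k => tmin (f k)) :=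
    ⟨R, by rintro _ ⟨k, rfl⟩; exact hR _ (hfP k)⟩
  have hlim := tendsto_atTop_ciSup hmono hbdd
  have hflim : Tendsto f atTop (𝓝 s) := tendsto_addr_of_agree hsA
  have hsJ : (⨆ k, tmin (f k), s) ∈ JF := isClosed_JF.mem_of_tendsto (hlim.prodMk_nhds hflim)
    (.of_forall fun k => (hP _ (hfP k)).tmin_mem)
  have hs : ExpBounded s := ⟨_, hsJ⟩
  have hτ : ⨆ k, tmin (f k) = tmin s :=
    le_antisymm (ciSup_le fun k => tmin_le_tmin hs (hsD k)) (tmin_le hsJ)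
  rw [hτ] at hlim
  have hPs : P s := hclosed f s hfP hs (hsD 0) (hlim.prodMk_nhds hflim)
  obtain ⟨V, hV, hVP⟩ := hopen s hPs
  obtain ⟨A, hA', B, hB, hAB⟩ := mem_nhds_prod_iff.1 hV
  obtain ⟨δ, hδ, hδA⟩ := Metric.mem_nhds_iff.1 hA'
  have hJδ : (tmin s + δ / 2, s) ∈ JF :=
    JF_mono hs.tmin_mem (by simp; linarith) fun _ => le_rfl
  choose w hwE hwD hwA hw1 hw2 using
    exists_dominates_tmin_near hJδ (by positivity : 0 < δ / 4)
  have hev : ∀ᶠ k in atTop, w k ∈ B := tendsto_addr_of_agree hwA hB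
  have hev' : ∀ᶠ k : ℕ in atTop, 1 / ((k : ℝ) + 1) < δ / 4 :=
    tendsto_one_div_add_atTop_nhds_zero_nat.eventually_lt_const (by positivity)
  obtain ⟨k, hkB, hkδ⟩ := (hev.and hev').exists
  have hPw : P (w k) := by
    refine hVP _ (hwE k) (hwD k) (hAB ⟨hδA ?_, hkB⟩)
    rw [Metric.mem_ball, Real.dist_eq, abs_lt]
    constructor <;> linarith [hw1 k, hw2 k]
  have hle := hfM k (w k) hPw ((hwD k).trans (hsD k)) fun n hn => by
    rw [hwA k n hn, hsA k n hn]
  linarith [hw2 k, tmin_le_tmin hs (hsD (k + 1))]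

theorem inter_nonempty_of_infty_mem {Q : ℝ} {U V : Set (OnePoint (ℝ × Addr))}
    (hU : IsOpen U) (hV : IsOpen V) (hinf : ∞ ∈ U)
    (hcov : ∀ x ∈ escEndF ∩ JQ Q, (x : OnePoint (ℝ × Addr)) ∈ U ∪ V)
    {y : ℝ × Addr} (hy : y ∈ escEndF ∩ JQ Q) (hyV : (y : OnePoint (ℝ × Addr)) ∈ V) :
    ∃ x ∈ escEndF ∩ JQ Q, (x : OnePoint (ℝ × Addr)) ∈ U ∩ V := by
  by_contra! hdisj
  have hU' : IsOpen ((↑) ⁻¹' U : Set (ℝ × Addr)) := hU.preimage OnePoint.continuous_coe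
  have hV' : IsOpen ((↑) ⁻¹' V : Set (ℝ × Addr)) := hV.preimage OnePoint.continuous_coe
  have hK : IsCompact ((↑) ⁻¹' U : Set (ℝ × Addr))ᶜ := (OnePoint.isOpen_def.1 hU).1 hinf
  obtain ⟨R, hR⟩ := (hK.image continuous_fst).bddAbove
  obtain ⟨⟨s₀, hs₀, rfl⟩, hyQ⟩ := hy
  refine false_of_bounded_clopen (R := R) (s₀ := s₀)
    (P := fun s => (Fast s ∧ (tmin s, s) ∈ JQ Q) ∧
      (((tmin s, s) : ℝ × Addr) : OnePoint (ℝ × Addr)) ∈ V)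
    (fun s hs => hs.1.1.1) (fun s hs => hR ⟨(tmin s, s), fun h => ?_, rfl⟩)
    ⟨⟨hs₀, hyQ⟩, hyV⟩ (fun f s hf hs hd hlim => ?_) (fun s hs => ⟨_, hV'.mem_nhds hs.2, ?_⟩)
  · exact hdisj _ ⟨mem_escEndF_iff.2 hs.1.1, hs.1.2⟩ ⟨h, hs.2⟩
  · have hf0 := (hf 0).1
    have hE : Fast s ∧ (tmin s, s) ∈ JQ Q :=
      ⟨hf0.1.of_dominates hs hd, mem_JQ_of_dominates hf0.1.1 hf0.2 hs.tmin_mem hd⟩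
    refine ⟨hE, (hcov _ ⟨mem_escEndF_iff.2 hE.1, hE.2⟩).resolve_left fun h => ?_⟩
    obtain ⟨k, hk⟩ := (hlim.eventually (hU'.mem_nhds h)).exists
    exact hdisj _ ⟨mem_escEndF_iff.2 (hf k).1.1, (hf k).1.2⟩ ⟨hk, (hf k).2⟩
  · exact fun u hu hd huV => ⟨⟨hs.1.1.of_dominates hu hd,
      mem_JQ_of_dominates hs.1.1.1 hs.1.2 hu.tmin_mem hd⟩, huV⟩

theorem isConnected_insert_infty (Q : ℝ) :
    IsConnected (insert (∞ : OnePoint (ℝ × Addr))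
      ((fun x : ℝ × Addr => (x : OnePoint (ℝ × Addr))) '' (escEndF ∩ JQ Q))) := by
  have key : ∀ U V : Set (OnePoint (ℝ × Addr)), IsOpen U → IsOpen V → ∞ ∈ U →
      insert (∞ : OnePoint (ℝ × Addr))
        ((fun x : ℝ × Addr => (x : OnePoint (ℝ × Addr))) '' (escEndF ∩ JQ Q)) ⊆ U ∪ V →
      (insert (∞ : OnePoint (ℝ × Addr))
        ((fun x : ℝ × Addr => (x : OnePoint (ℝ × Addr))) '' (escEndF ∩ JQ Q)) ∩ V).Nonempty →
      (insert (∞ : OnePoint (ℝ × Addr))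
        ((fun x : ℝ × Addr => (x : OnePoint (ℝ × Addr))) '' (escEndF ∩ JQ Q))
          ∩ (U ∩ V)).Nonempty := by
    rintro U V hU hV hinf hcov ⟨_, rfl | ⟨y, hy, rfl⟩, hyV⟩
    · exact ⟨∞, mem_insert _ _, hinf, hyV⟩
    · obtain ⟨x, hx, hxUV⟩ := inter_nonempty_of_infty_mem hU hV hinf
        (fun x hx => hcov (mem_insert_of_mem _ ⟨x, hx, rfl⟩)) hy hyV
      exact ⟨x, mem_insert_of_mem _ ⟨x, hx, rfl⟩, hxUV⟩
  refine ⟨⟨∞, mem_insert _ _⟩, fun U V hU hV hcov hneU hneV => ?_⟩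
  rcases hcov (mem_insert _ _) with h | h
  · exact key U V hU hV h hcov hneV
  · rw [inter_comm U V]
    exact key V U hV hU h (by rwa [union_comm]) hneU

theorem totallySeparatedSpace_of_subset_escEndF {S : Set (ℝ × Addr)} (hS : S ⊆ escEndF) :
    TotallySeparatedSpace S := by
  refine totallySeparatedSpace_iff_exists_isClopen.2 fun x y hxy => ?_
  have hne : x.1.2 ≠ y.1.2 := by
    intro h
    obtain ⟨s, -, hs⟩ := hS x.2
    obtain ⟨u, -, hu⟩ := hS y.2
    refine hxy (Subtype.ext ?_)
    rw [hs, hu] at h ⊢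
    simp only at h
    rw [h]
  obtain ⟨n, hn⟩ := Function.ne_iff.1 hne
  have hc : Continuous fun z : S => z.1.2 n :=
    (continuous_apply n).comp (continuous_snd.comp continuous_subtype_val)
  exact ⟨_, (isClopen_discrete {x.1.2 n}).preimage hc, rfl, hn.symm⟩

/-- **Escaping endpoints in other sub-fans.** (a) If `(t_{s⁰}, s⁰) ∈ J_{≥Q}(𝓕)` then
`X_{s⁰}(𝓕) ⊆ J_{≥Q}(𝓕)`. (b) `∞` is an explosion point for `Ẽ_{≥Q}(𝓕) ∪ {∞}`:
this set is connected in the one-point compactification of `ℝ × ℤ^ℕ` and `Ẽ_{≥Q}(𝓕)` is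
totally separated. -/
theorem escaping_endpoints_JQ_explode (Q : ℝ) (hQ : 0 ≤ Q) :
    (∀ s0 : Addr, ExpBounded s0 → (tmin s0, s0) ∈ JQ Q → Xsub s0 ⊆ JQ Q) ∧
    IsConnected (insert (∞ : OnePoint (ℝ × Addr))
      ((fun x : ℝ × Addr => (x : OnePoint (ℝ × Addr))) '' (escEndF ∩ JQ Q))) ∧
    TotallySeparatedSpace ↥(escEndF ∩ JQ Q) := by
  exact ⟨fun s0 hs0 hsQ x hx => mem_JQ_of_dominates hs0 hsQ hx.1 hx.2,
    isConnected_insert_infty Q,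
    totallySeparatedSpace_of_subset_escEndF inter_subset_left⟩

end
end
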